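/- For all n ≥ 1 and 0 ≤ r ≤ n, the identity |GL_n(F_q)|² = N_r · |P_r| · q^{r(n−r)} · |GL_{n−r}(F_q)| holds, where N_r = q^{r(r-1)/2}[n,r]_q² ∏_{i=1}^{r}(q^i−1) is the number of rank-r matrices in M_n(F_q) and |P_r| = q^{n(n−1)/2}(q−1)^n ∑_{w ∈ S_r×S_{n−r}} q^{ℓ(w)} is the order of the standard maximal parabolic with block sizes (r, n−r). -/

import Mathlib

open scoped Classical

/-- The Gaussian binomial coefficient `[n, r]_q = ∏_{i=0}^{r-1} (q^{n-i} − 1)/(q^{r-i} − 1)`. -/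
noncomputable def gaussBinom (q : ℚ) (n r : ℕ) : ℚ :=
  ∏ i ∈ Finset.range r, (q ^ (n - i) - 1) / (q ^ (r - i) - 1)

/-- Number of inversions of a permutation of `Fin n`. -/
def invLength {n : ℕ} (w : Equiv.Perm (Fin n)) : ℕ :=
  (Finset.univ.filter fun p : Fin n × Fin n => p.1 < p.2 ∧ w p.2 < w p.1).card

/-- The permutation of `Fin (n+1)` sending `0` to `p` and acting like `σ` on the rest. -/
noncomputable def mkPerm {n : ℕ} (p : Fin (n + 1)) (σ : Equiv.Perm (Fin n)) :
    Equiv.Perm (Fin (n + 1)) :=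
  ((finSuccEquiv' 0).trans (Equiv.optionCongr σ)).trans (finSuccEquiv' p).symm

lemma mkPerm_zero {n : ℕ} (p : Fin (n + 1)) (σ : Equiv.Perm (Fin n)) : mkPerm p σ 0 = p := by
  simp [mkPerm]

lemma mkPerm_succ {n : ℕ} (p : Fin (n + 1)) (σ : Equiv.Perm (Fin n)) (i : Fin n) :
    mkPerm p σ i.succ = p.succAbove (σ i) := by
  have h : finSuccEquiv' (0 : Fin (n+1)) i.succ = some i := by
    rw [← Fin.succAbove_zero]; exact finSuccEquiv'_succAbove _ _
  simp [mkPerm, h]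

lemma mkPerm_bij (n : ℕ) :
    Function.Bijective (fun x : Fin (n + 1) × Equiv.Perm (Fin n) => mkPerm x.1 x.2) := by
  rw [Fintype.bijective_iff_injective_and_card]
  constructor
  · rintro ⟨p, σ⟩ ⟨p', σ'⟩ h
    have h : mkPerm p σ = mkPerm p' σ' := h
    have h0 : p = p' := by rw [← mkPerm_zero p σ, h, mkPerm_zero]
    subst h0
    congr 1
    ext1 i
    have := congrArg (fun w => w i.succ) h
    simp only [mkPerm_succ] at this
    exact Fin.succAbove_right_injective this
  · simp [Fintype.card_perm, Nat.factorial_succ]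

lemma sum_perm_succ {n : ℕ} (f : Equiv.Perm (Fin (n + 1)) → ℚ) :
    ∑ w, f w = ∑ p : Fin (n + 1), ∑ σ : Equiv.Perm (Fin n), f (mkPerm p σ) := by
  rw [← Fintype.sum_prod_type']
  exact ((mkPerm_bij n).sum_comp f).symm

lemma invLength_eq {n : ℕ} (w : Equiv.Perm (Fin n)) :
    invLength w = ∑ i : Fin n, ∑ j : Fin n, if i < j ∧ w j < w i then 1 else 0 := by
  rw [invLength, Finset.card_filter, Fintype.sum_prod_type]

lemma row_count {n : ℕ} (p : Fin (n + 1)) (σ : Equiv.Perm (Fin n)) :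
    (∑ j : Fin n, if p.succAbove (σ j) < p then 1 else 0) = (p : ℕ) := by
  rw [Equiv.sum_comp σ (fun j => if p.succAbove j < p then 1 else 0)]
  simp only [Fin.succAbove_lt_iff_castSucc_lt]
  simp only [Fin.lt_def, Fin.val_castSucc]
  rw [Fin.sum_univ_eq_sum_range (fun j => if j < (p : ℕ) then 1 else 0) n,
    ← Finset.card_filter]
  have : (Finset.range n).filter (fun j => j < (p : ℕ)) = Finset.range p := by
    ext j; simp; omega
  rw [this, Finset.card_range]

lemma invLength_mkPerm {n : ℕ} (p : Fin (n + 1)) (σ : Equiv.Perm (Fin n)) :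
    invLength (mkPerm p σ) = p + invLength σ := by
  rw [invLength_eq, Fin.sum_univ_succ]
  congr 1
  · rw [Fin.sum_univ_succ]
    simp only [mkPerm_zero, mkPerm_succ]
    simpa using row_count p σ
  · rw [invLength_eq]
    refine Finset.sum_congr rfl fun i _ => ?_
    rw [Fin.sum_univ_succ]
    simp [mkPerm_succ, Fin.succAbove_lt_succAbove_iff]

/-- The block-preservation predicate. -/
def pres (n r : ℕ) (w : Equiv.Perm (Fin n)) : Prop :=
  ∀ i : Fin n, ((i : ℕ) < r ↔ ((w i : ℕ) < r))

lemma pres_mk_zero {n : ℕ} (p : Fin (n + 1)) (σ : Equiv.Perm (Fin n)) :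
    pres (n + 1) 0 (mkPerm p σ) ↔ ((p : ℕ) < n + 1 ∧ pres n 0 σ) := by
  have := p.isLt
  simp [pres]
  omega

lemma pres_mk_succ {n r : ℕ} (p : Fin (n + 1)) (σ : Equiv.Perm (Fin n)) :
    pres (n + 1) (r + 1) (mkPerm p σ) ↔ ((p : ℕ) < r + 1 ∧ pres n r σ) := by
  unfold pres
  rw [Fin.forall_fin_succ]
  simp only [mkPerm_zero, mkPerm_succ, Fin.val_zero, Fin.val_succ]
  have h0 : (0 < r + 1 ↔ (p : ℕ) < r + 1) ↔ (p : ℕ) < r + 1 := by simp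
  rw [h0]
  refine and_congr_right fun hp => forall_congr' fun i => ?_
  have : ((p.succAbove (σ i) : Fin (n + 1)) : ℕ) < r + 1 ↔ (σ i : ℕ) < r := by
    rcases lt_or_ge (σ i).castSucc p with h | h
    · rw [Fin.succAbove_of_castSucc_lt _ _ h]
      simp only [Fin.lt_def, Fin.val_castSucc] at h ⊢
      omega
    · rw [Fin.succAbove_of_le_castSucc _ _ h]
      simp
  rw [this]
  simp

noncomputable def Y (q : ℚ) (n r : ℕ) : ℚ :=
  ∑ w : Equiv.Perm (Fin n), if pres n r w then q ^ invLength w else 0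

lemma Y_step (q : ℚ) (n r s b : ℕ) (hb : b ≤ n + 1)
    (h : ∀ (p : Fin (n + 1)) (σ : Equiv.Perm (Fin n)),
      pres (n + 1) r (mkPerm p σ) ↔ ((p : ℕ) < b ∧ pres n s σ)) :
    (q - 1) * Y q (n + 1) r = (q ^ b - 1) * Y q n s := by
  have h1 : Y q (n + 1) r = (∑ p : Fin (n + 1), if (p : ℕ) < b then q ^ (p : ℕ) else 0) *
      Y q n s := by
    rw [Y, sum_perm_succ, Y, Finset.sum_mul_sum]
    refine Finset.sum_congr rfl fun p _ => Finset.sum_congr rfl fun σ _ => ?_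
    rw [invLength_mkPerm, pow_add]
    by_cases h1 : (p : ℕ) < b <;> by_cases h2 : pres n s σ <;> simp [h, h1, h2]
  rw [h1, Fin.sum_univ_eq_sum_range (fun p => if p < b then q ^ p else 0) (n + 1),
    ← Finset.sum_filter]
  have : (Finset.range (n + 1)).filter (fun j => j < b) = Finset.range b := by
    ext j; simp; omega
  rw [this, ← mul_assoc, mul_comm (q - 1), geom_sum_mul]

/-- `∏_{i=1}^k (q^i - 1)`. -/
def A (q : ℚ) (k : ℕ) : ℚ := ∏ i ∈ Finset.range k, (q ^ (i + 1) - 1)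

lemma A_succ (q : ℚ) (k : ℕ) : A q (k + 1) = A q k * (q ^ (k + 1) - 1) :=
  Finset.prod_range_succ _ _

lemma A_ne {q : ℚ} (hq : 1 < q) (k : ℕ) : A q k ≠ 0 := by
  refine Finset.prod_ne_zero_iff.2 fun i _ => ?_
  exact (sub_pos.2 (one_lt_pow₀ hq (by omega))).ne'

lemma Y_eq (q : ℚ) (n : ℕ) : ∀ r ≤ n, (q - 1) ^ n * Y q n r = A q r * A q (n - r) := by
  induction n with
  | zero =>
    intro r hr
    obtain rfl : r = 0 := by omega
    simp [Y, A, pres, invLength]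
  | succ n ih =>
    intro r hr
    rw [pow_succ, mul_assoc]
    rcases r with _ | r
    · rw [Y_step q n 0 0 (n + 1) le_rfl pres_mk_zero, mul_left_comm, ih 0 (by omega)]
      simp only [Nat.sub_zero, A_succ]
      ring
    · rw [Y_step q n (r + 1) r (r + 1) hr pres_mk_succ, mul_left_comm, ih r (by omega)]
      simp only [Nat.add_sub_add_right, A_succ]
      ring

lemma tri_succ (k : ℕ) : (k + 1) * (k + 1 - 1) / 2 = k * (k - 1) / 2 + k := by
  rw [← Nat.choose_two_right, ← Nat.choose_two_right, Nat.choose_succ_succ' k 1]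
  simp [add_comm]

lemma prod_GL (q : ℚ) (n : ℕ) :
    ∏ i ∈ Finset.range n, (q ^ n - q ^ i) = q ^ (n * (n - 1) / 2) * A q n := by
  induction n with
  | zero => simp [A]
  | succ n ih =>
    rw [Finset.prod_range_succ', tri_succ, A_succ]
    have : ∏ i ∈ Finset.range n, (q ^ (n + 1) - q ^ (i + 1)) =
        ∏ i ∈ Finset.range n, q * (q ^ n - q ^ i) :=
      Finset.prod_congr rfl fun i _ => by ring
    rw [this, Finset.prod_mul_distrib, ih, Finset.prod_const, Finset.card_range, pow_zero]
    ring

lemma card_GL_A (F : Type*) [Field F] [Fintype F] (q : ℕ) (hq : Fintype.card F = q) (n : ℕ) :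
    (Nat.card (GL (Fin n) F) : ℚ) = (q : ℚ) ^ (n * (n - 1) / 2) * A q n := by
  have hq1 : 1 ≤ q := by rw [← hq]; exact Fintype.card_pos
  rw [Matrix.card_GL_field, ← prod_GL, hq, Fin.prod_univ_eq_prod_range (fun i => q ^ n - q ^ i) n]
  push_cast
  refine Finset.prod_congr rfl fun i hi => ?_
  rw [Nat.cast_sub (Nat.pow_le_pow_right hq1 (Finset.mem_range.1 hi).le)]
  push_cast
  rfl

lemma prod_top (q : ℚ) (n r : ℕ) (hr : r ≤ n) :
    (∏ i ∈ Finset.range r, (q ^ (n - i) - 1)) * A q (n - r) = A q n := by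
  induction r with
  | zero => simp
  | succ r ih =>
    rw [← ih (by omega), Finset.prod_range_succ, mul_assoc]
    obtain ⟨m, rfl⟩ := Nat.exists_eq_add_of_le hr
    have h1 : r + 1 + m - r = m + 1 := by omega
    have h2 : r + 1 + m - (r + 1) = m := by omega
    rw [h1, h2, A_succ, mul_comm (A q m)]

lemma gauss_eq {q : ℚ} (hq : 1 < q) (n r : ℕ) (hr : r ≤ n) :
    gaussBinom q n r = A q n / (A q r * A q (n - r)) := by
  have h1 := prod_top q n r hr
  have h2 := prod_top q r r le_rfl
  have h0 : A q (r - r) = 1 := by simp [A]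
  rw [h0, mul_one] at h2
  rw [gaussBinom, Finset.prod_div_distrib, h2, ← h1]
  have := A_ne hq r
  have := A_ne hq (n - r)
  field_simp

lemma tri_add (r m : ℕ) :
    (r + m) * (r + m - 1) / 2 = r * (r - 1) / 2 + m * (m - 1) / 2 + r * m := by
  induction m with
  | zero => simp
  | succ m ih =>
    rw [← add_assoc, tri_succ, ih, tri_succ]
    ring

/-- Orbit–stabilizer for the `(GL_n × GL_n)`-action on `M_n(F_q)`:
`|GL_n(F_q)|² = N_r · |P_r| · q^{r(n−r)} · |GL_{n−r}(F_q)|`, where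
`N_r = q^{r(r-1)/2}[n,r]_q² ∏_{i=1}^{r}(q^i−1)` is the number of rank-`r` matrices and
`|P_r| = q^{n(n−1)/2}(q−1)^n ∑_{w ∈ S_r×S_{n−r}} q^{ℓ(w)}`. -/
theorem GL_sq_eq_orbit_mul_stabilizer (F : Type*) [Field F] [Fintype F] (q : ℕ)
    (hq : Fintype.card F = q) (n r : ℕ) (hn : 1 ≤ n) (hr : r ≤ n) :
    (Nat.card (GL (Fin n) F) : ℚ) ^ 2 =
      ((q : ℚ) ^ (r * (r - 1) / 2) * (gaussBinom q n r) ^ 2 *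
          ∏ i ∈ Finset.range r, ((q : ℚ) ^ (i + 1) - 1)) *
        ((q : ℚ) ^ (n * (n - 1) / 2) * ((q : ℚ) - 1) ^ n *
          ∑ w ∈ Finset.univ.filter
              (fun w : Equiv.Perm (Fin n) => ∀ i : Fin n, ((i : ℕ) < r ↔ ((w i : ℕ) < r))),
            (q : ℚ) ^ invLength w) *
        (q : ℚ) ^ (r * (n - r)) * (Nat.card (GL (Fin (n - r)) F) : ℚ) := by
  have hq1 : (1 : ℚ) < q := by
    have : 1 < q := by rw [← hq]; exact Fintype.one_lt_card
    exact_mod_cast this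
  have hY : (∑ w ∈ Finset.univ.filter
              (fun w : Equiv.Perm (Fin n) => ∀ i : Fin n, ((i : ℕ) < r ↔ ((w i : ℕ) < r))),
            (q : ℚ) ^ invLength w) = Y q n r := by
    rw [Y, Finset.sum_filter]
    refine Finset.sum_congr rfl fun w _ => ?_
    unfold pres
    congr
  have hA : ∏ i ∈ Finset.range r, ((q : ℚ) ^ (i + 1) - 1) = A q r := rfl
  rw [hY, hA, mul_assoc ((q : ℚ) ^ (n * (n - 1) / 2)), Y_eq _ n r hr, card_GL_A F q hq,
    card_GL_A F q hq, gauss_eq hq1 n r hr]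
  obtain ⟨m, rfl⟩ := Nat.exists_eq_add_of_le hr
  rw [Nat.add_sub_cancel_left, tri_add]
  have h1 := A_ne hq1 r
  have h2 := A_ne hq1 m
  field_simp
  ring
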